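/- There is no blocking semioval with exactly 25 points in PG(2,11) that has a 10-secant line. -/

import Mathlib

instance : Fact (Nat.Prime 11) := ⟨by norm_num⟩

/-- The points of `PG(2,11)`: the projectivization of `(ZMod 11)^3`. -/
abbrev PGPoint : Type := Projectivization (ZMod 11) (Fin 3 → ZMod 11)

/-- The lines of `PG(2,11)`: the 2-dimensional subspaces of `(ZMod 11)^3`. -/
abbrev PGLine : Type :=
  {W : Submodule (ZMod 11) (Fin 3 → ZMod 11) // Module.finrank (ZMod 11) W = 2}

/-- Incidence: a point lies on a line when its representing 1-dimensional
subspace is contained in the line's 2-dimensional subspace. -/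
def PGmem (P : PGPoint) (L : PGLine) : Prop := Projectivization.submodule P ≤ L.val

/-- The set of points lying on a line. -/
def linePts (L : PGLine) : Set PGPoint := {P | PGmem P L}

/-- The set of points of `S` lying on the line `L`. -/
def secantPts (S : Set PGPoint) (L : PGLine) : Set PGPoint := {P ∈ S | PGmem P L}

/-- A line is a `k`-secant to `S` if it meets `S` in exactly `k` points. -/
def IsSecant (S : Set PGPoint) (k : ℕ) (L : PGLine) : Prop := (secantPts S L).ncard = k

/-- A tangent line to `S` is a 1-secant. -/
def IsTangent (S : Set PGPoint) (L : PGLine) : Prop := IsSecant S 1 L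

/-- A blocking set: every line meets `S`, but `S` contains no line. -/
def IsBlockingSet (S : Set PGPoint) : Prop :=
  (∀ L : PGLine, (secantPts S L).Nonempty) ∧ ∀ L : PGLine, ¬ linePts L ⊆ S

/-- A semioval: every point of `S` lies on exactly one tangent line to `S`. -/
def IsSemioval (S : Set PGPoint) : Prop :=
  ∀ P ∈ S, ∃! L : PGLine, PGmem P L ∧ IsTangent S L

/-- A blocking semioval is both a blocking set and a semioval. -/
def IsBlockingSemioval (S : Set PGPoint) : Prop := IsBlockingSet S ∧ IsSemioval S

open MvPolynomial in
/-- **Jamison's theorem**, projective form. If a family of points misses the hyperplane `f = 0`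
but meets every other hyperplane, then it has more than `(q - 1) (d - 1)` members,
where `d` is the dimension of the ambient vector space. -/
theorem card_sub_one_mul_lt_of_forall_hyperplane {K σ γ : Type*} [Field K] [Fintype K]
    [Fintype σ] (f : σ → K) (B : Finset γ) (v : γ → σ → K) (hB : B.Nonempty)
    (hf : ∀ b ∈ B, f ⬝ᵥ v b ≠ 0)
    (hmeet : ∀ g : σ → K, (∀ c : K, g ≠ c • f) → ∃ b ∈ B, g ⬝ᵥ v b = 0) :
    (Fintype.card K - 1) * Fintype.card σ < (Fintype.card K - 1) + B.card := by
  classical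
  by_contra! hle
  obtain ⟨b₀, hb₀⟩ := hB
  let form (b : γ) : MvPolynomial σ K := ∑ i, C (v b i) * X i
  have eval_form (b : γ) (g : σ → K) : eval g (form b) = g ⬝ᵥ v b := by
    simp [form, dotProduct, mul_comm]
  have deg_form (b : γ) : (form b).totalDegree ≤ 1 :=
    totalDegree_finsetSum_le fun i _ =>
      (totalDegree_mul _ _).trans (by simp)
  let F : MvPolynomial σ K :=
    (1 - (form b₀ - 1) ^ (Fintype.card K - 1)) * ∏ b ∈ B.erase b₀, form b
  have deg_F : F.totalDegree < (Fintype.card K - 1) * Fintype.card σ := by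
    have hsub : (form b₀ - 1).totalDegree ≤ 1 :=
      (totalDegree_sub _ _).trans (by simp [deg_form])
    have hleft : (1 - (form b₀ - 1) ^ (Fintype.card K - 1)).totalDegree ≤ Fintype.card K - 1 := by
      refine (totalDegree_sub _ _).trans (max_le (by simp) ((totalDegree_pow _ _).trans ?_))
      simpa using Nat.mul_le_mul_left (Fintype.card K - 1) hsub
    have hright : (∏ b ∈ B.erase b₀, form b).totalDegree ≤ B.card - 1 := by
      refine (totalDegree_finsetProd _ _).trans ((Finset.sum_le_card_nsmul _ _ 1 ?_).trans ?_)
      · exact fun b _ => deg_form b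
      · simp [Finset.card_erase_of_mem hb₀]
    have hmul := totalDegree_mul (1 - (form b₀ - 1) ^ (Fintype.card K - 1))
      (∏ b ∈ B.erase b₀, form b)
    have := Finset.card_pos.mpr ⟨b₀, hb₀⟩
    change (_ * _ : MvPolynomial σ K).totalDegree < _
    omega
  have hq : Fintype.card K - 1 ≠ 0 := by
    have := Fintype.one_lt_card (α := K)
    omega
  have eval_F (g : σ → K) : eval g F =
      (1 - (g ⬝ᵥ v b₀ - 1) ^ (Fintype.card K - 1)) * ∏ b ∈ B.erase b₀, g ⬝ᵥ v b := by
    simp [F, eval_form]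
  have hsum := sum_eval_eq_zero F deg_F
  rw [Finset.sum_eq_single ((f ⬝ᵥ v b₀)⁻¹ • f)] at hsum
  · rw [eval_F, smul_dotProduct, smul_eq_mul, inv_mul_cancel₀ (hf b₀ hb₀), sub_self,
      zero_pow hq, sub_zero, one_mul, Finset.prod_eq_zero_iff] at hsum
    obtain ⟨b, hb, hzero⟩ := hsum
    rw [smul_dotProduct, smul_eq_mul] at hzero
    exact mul_ne_zero (inv_ne_zero (hf b₀ hb₀)) (hf b (Finset.mem_of_mem_erase hb)) hzero
  · intro g _ hg
    rw [eval_F]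
    by_cases hone : g ⬝ᵥ v b₀ = 1
    · obtain ⟨b, hb, hzero⟩ := hmeet g fun c hc => hg <| by
        rw [hc, smul_dotProduct, smul_eq_mul] at hone
        rw [hc, eq_inv_of_mul_eq_one_left hone]
      have hne : b ≠ b₀ := by
        rintro rfl
        exact zero_ne_one (hzero.symm.trans hone)
      rw [Finset.prod_eq_zero (Finset.mem_erase.mpr ⟨hne, hb⟩) hzero, mul_zero]
    · rw [FiniteField.pow_card_sub_one_eq_one _ (sub_ne_zero.mpr hone), sub_self, zero_mul]
  · simp

/-- If any two members of a set of size at most `2k` have a common neighbour,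
then `k` neighbours suffice to dominate the set. -/
theorem Finset.exists_card_le_of_forall_pair {α β : Type*} (r : α → β → Prop) (p : β → Prop)
    (k : ℕ) (M : Finset α) (hM : M.card ≤ 2 * k)
    (hr : ∀ a ∈ M, ∀ a' ∈ M, ∃ b, p b ∧ r a b ∧ r a' b) :
    ∃ C : Finset β, C.card ≤ k ∧ (∀ b ∈ C, p b) ∧ ∀ a ∈ M, ∃ b ∈ C, r a b := by
  classical
  induction k generalizing M with
  | zero =>
    obtain rfl : M = ∅ := Finset.card_eq_zero.mp (by omega)
    exact ⟨∅, by simp⟩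
  | succ k ih =>
    obtain rfl | ⟨a, ha⟩ := M.eq_empty_or_nonempty
    · exact ⟨∅, by simp⟩
    obtain ⟨a', ha', hcard⟩ : ∃ a' ∈ M, ((M.erase a).erase a').card ≤ 2 * k := by
      have hcard := Finset.card_erase_of_mem ha
      obtain hempty | ⟨a', ha'⟩ := (M.erase a).eq_empty_or_nonempty
      · exact ⟨a, ha, by simp [hempty]⟩
      · refine ⟨a', Finset.mem_of_mem_erase ha', ?_⟩
        rw [Finset.card_erase_of_mem ha']
        omega
    obtain ⟨b, hb, hab, hab'⟩ := hr a ha a' ha'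
    obtain ⟨C, hC, hp, hcover⟩ := ih _ hcard fun x hx y hy =>
      hr x (by simp_all) y (by simp_all)
    refine ⟨insert b C, (Finset.card_insert_le _ _).trans (by omega), ?_, fun x hx => ?_⟩
    · simpa [hb] using hp
    · by_cases hxa : x = a
      · exact ⟨b, by simp, hxa ▸ hab⟩
      by_cases hxa' : x = a'
      · exact ⟨b, by simp, hxa' ▸ hab'⟩
      obtain ⟨c, hc, hxc⟩ := hcover x (by simp [hxa, hxa', hx])
      exact ⟨c, by simp [hc], hxc⟩

theorem PGmem_iff_rep_mem (P : PGPoint) (L : PGLine) : PGmem P L ↔ P.rep ∈ L.val := by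
  rw [PGmem, Projectivization.submodule_eq, Submodule.span_singleton_le_iff_mem]

theorem PGmem_mk_iff (v : Fin 3 → ZMod 11) (hv : v ≠ 0) (L : PGLine) :
    PGmem (Projectivization.mk (ZMod 11) v hv) L ↔ v ∈ L.val := by
  rw [PGmem, Projectivization.submodule_mk, Submodule.span_singleton_le_iff_mem]

theorem PGLine.eq_of_le {L M : PGLine} (h : L.val ≤ M.val) : L = M :=
  Subtype.ext (Submodule.eq_of_le_of_finrank_eq h (L.2.trans M.2.symm))

/-- A line not equal to `M` has a point outside `M`. -/
theorem PGLine.exists_PGmem_not_PGmem {L M : PGLine} (h : L ≠ M) :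
    ∃ P, PGmem P L ∧ ¬ PGmem P M := by
  obtain ⟨v, hvL, hvM⟩ := SetLike.not_le_iff_exists.mp fun hle => h (PGLine.eq_of_le hle)
  have hv : v ≠ 0 := by
    rintro rfl
    exact hvM M.val.zero_mem
  exact ⟨Projectivization.mk _ v hv, (PGmem_mk_iff v hv L).mpr hvL,
    fun hP => hvM ((PGmem_mk_iff v hv M).mp hP)⟩

/-- Any two lines meet. -/
theorem PGLine.exists_PGmem_PGmem (L M : PGLine) : ∃ P, PGmem P L ∧ PGmem P M := by
  have hdim := Submodule.finrank_sup_add_finrank_inf_eq L.val M.val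
  have hsup := (L.val ⊔ M.val).finrank_le
  rw [L.2, M.2] at hdim
  rw [Module.finrank_fin_fun] at hsup
  have hne : L.val ⊓ M.val ≠ ⊥ := by
    intro hbot
    rw [hbot, finrank_bot] at hdim
    omega
  obtain ⟨v, hvmem, hv⟩ := Submodule.exists_mem_ne_zero_of_ne_bot hne
  exact ⟨Projectivization.mk _ v hv, (PGmem_mk_iff v hv L).mpr hvmem.1,
    (PGmem_mk_iff v hv M).mpr hvmem.2⟩

/-- Two distinct lines meet in at most one point. -/
theorem PGLine.eq_of_PGmem {L M : PGLine} (h : L ≠ M) {P Q : PGPoint}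
    (hPL : PGmem P L) (hPM : PGmem P M) (hQL : PGmem Q L) (hQM : PGmem Q M) : P = Q := by
  have hle : Module.finrank (ZMod 11) ↥(L.val ⊓ M.val) ≤ 1 := by
    by_contra! hlt
    refine h (PGLine.eq_of_le (inf_eq_left.mp ?_))
    exact Submodule.eq_of_le_of_finrank_le inf_le_left (by rw [L.2]; omega)
  have eq_inf {R : PGPoint} (hL : PGmem R L) (hM : PGmem R M) : R.submodule = L.val ⊓ M.val :=
    Submodule.eq_of_le_of_finrank_le (le_inf hL hM) (by rwa [R.finrank_submodule])
  exact Projectivization.submodule_injective ((eq_inf hPL hPM).trans (eq_inf hQL hQM).symm)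

/-- Every nonzero vector of coefficients defines a line. -/
theorem PGLine.exists_forall_mem_iff {g : Fin 3 → ZMod 11} (hg : g ≠ 0) :
    ∃ L : PGLine, ∀ v, v ∈ L.val ↔ g ⬝ᵥ v = 0 := by
  have hne : dotProductEquiv (ZMod 11) (Fin 3) g ≠ 0 := by simpa using hg
  have hdim := Module.Dual.finrank_ker_add_one_of_ne_zero hne
  rw [Module.finrank_fin_fun] at hdim
  exact ⟨⟨LinearMap.ker (dotProductEquiv (ZMod 11) (Fin 3) g), by omega⟩, fun v => by simp⟩

/-- Every line is the zero set of a linear form, unique up to a scalar. -/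
theorem PGLine.exists_equation (L : PGLine) : ∃ f : Fin 3 → ZMod 11,
    (∀ v, v ∈ L.val ↔ f ⬝ᵥ v = 0) ∧
      ∀ g : Fin 3 → ZMod 11, (∀ v ∈ L.val, g ⬝ᵥ v = 0) → ∃ c : ZMod 11, g = c • f := by
  have hlt : L.val < ⊤ := by
    refine lt_top_iff_ne_top.mpr fun htop => ?_
    have := L.2
    rw [htop, finrank_top, Module.finrank_fin_fun] at this
    omega
  obtain ⟨φ, hφ, hle⟩ := Submodule.exists_le_ker_of_lt_top L.val hlt
  obtain ⟨f, rfl⟩ := (dotProductEquiv (ZMod 11) (Fin 3)).surjective φ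
  obtain ⟨M, hM⟩ := PGLine.exists_forall_mem_iff (g := f) (by rintro rfl; simp at hφ)
  obtain rfl : L = M := PGLine.eq_of_le fun v hv => (hM v).mpr (by simpa using hle hv)
  refine ⟨f, hM, fun g hg => ?_⟩
  have hmem := mem_span_of_iInf_ker_le_ker (ι := Unit)
    (L := fun _ => dotProductEquiv (ZMod 11) (Fin 3) f)
    (K := dotProductEquiv (ZMod 11) (Fin 3) g)
    fun v hv => by simpa using hg v ((hM v).mpr (by simpa using hv))
  rw [Set.range_const, Submodule.mem_span_singleton] at hmem
  obtain ⟨c, hc⟩ := hmem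
  exact ⟨c, (dotProductEquiv (ZMod 11) (Fin 3)).injective (by rw [← hc, map_smul])⟩

/-- A nonempty set of affine points (with respect to the line `ℓ` at infinity)
meeting every affine line of `AG(2,11)` has at least 21 points. -/
theorem twenty_one_le_card_of_affine_blocking (ℓ : PGLine) (B : Finset PGPoint)
    (hne : B.Nonempty) (hoff : ∀ P ∈ B, ¬ PGmem P ℓ)
    (hmeet : ∀ L : PGLine, L ≠ ℓ → ∃ P ∈ B, PGmem P L) : 21 ≤ B.card := by
  obtain ⟨f, hf, hunique⟩ := ℓ.exists_equation
  have hcard := card_sub_one_mul_lt_of_forall_hyperplane f B Projectivization.rep hne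
    (fun P hP hzero => hoff P hP ((PGmem_iff_rep_mem P ℓ).mpr ((hf _).mpr hzero)))
    (fun g hg => by
      obtain ⟨L, hL⟩ := PGLine.exists_forall_mem_iff (g := g) (by simpa using hg 0)
      obtain ⟨P, hP, hPL⟩ := hmeet L (by
        rintro rfl
        obtain ⟨c, hc⟩ := hunique g fun v hv => (hL v).mp hv
        exact hg c hc)
      exact ⟨P, hP, (hL _).mp ((PGmem_iff_rep_mem P L).mp hPL)⟩)
  rw [ZMod.card, Fintype.card_fin] at hcard
  omega

/-- If a line `L ≠ ℓ` meets a blocking set only on `ℓ`,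
then it is a tangent at a point of `ℓ`. -/
theorem IsBlockingSet.exists_isTangent {S : Set PGPoint} (hS : IsBlockingSet S) {L ℓ : PGLine}
    (hne : L ≠ ℓ) (hsub : ∀ P ∈ S, PGmem P L → PGmem P ℓ) :
    ∃ Q ∈ secantPts S ℓ, PGmem Q L ∧ IsTangent S L := by
  obtain ⟨Q, hQS, hQL⟩ := hS.1 L
  have hQ := hsub Q hQS hQL
  refine ⟨Q, ⟨hQS, hQ⟩, hQL, Set.ncard_eq_one.mpr ⟨Q, ?_⟩⟩
  refine Set.eq_singleton_iff_unique_mem.mpr ⟨⟨hQS, hQL⟩, fun P hP => ?_⟩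
  exact PGLine.eq_of_PGmem hne hP.2 (hsub P hP.1 hP.2) hQL hQ

theorem no_25_point_blocking_semioval_with_10_secant :
    ¬ ∃ (S : Set PGPoint) (ℓ : PGLine),
        IsBlockingSemioval S ∧ S.ncard = 25 ∧ IsSecant S 10 ℓ := by
  classical
  rintro ⟨S, ℓ, ⟨hblock, hsemi⟩, hcard, hsec⟩
  have hfin : S.Finite := Set.finite_of_ncard_ne_zero (by omega)
  have hsub : secantPts S ℓ ⊆ S := Set.sep_subset _ _
  have hA : (S \ secantPts S ℓ).ncard = 15 := by
    rw [Set.ncard_sdiff hsub (hfin.subset hsub), hcard, hsec]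
  have hAfin : (S \ secantPts S ℓ).Finite := hfin.sdiff
  -- the lines other than `ℓ` that miss the affine part of `S`
  let missed : Set PGLine := {L | L ≠ ℓ ∧ ∀ P ∈ S, PGmem P L → PGmem P ℓ}
  choose! t ht htL htan using fun (L : PGLine) (hL : L ∈ missed) =>
    hblock.exists_isTangent hL.1 hL.2
  have hinj : Set.InjOn t missed := fun L hL M hM hLM =>
    (hsemi (t L) (ht L hL).1).unique ⟨htL L hL, htan L hL⟩ (hLM ▸ ⟨htL M hM, htan M hM⟩)
  have hmissed : missed.ncard ≤ 10 := by
    rw [← hsec]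
    exact Set.ncard_le_ncard_of_injOn t ht hinj (hfin.subset hsub)
  have hmfin : missed.Finite := Set.toFinite _
  obtain ⟨C, hC, hCoff, hCmeet⟩ := Finset.exists_card_le_of_forall_pair
    (fun (L : PGLine) P => PGmem P L) (fun P => ¬ PGmem P ℓ) 5 hmfin.toFinset
    (by rwa [← Set.ncard_eq_toFinset_card _ hmfin]) (by
      intro L hL M hM
      rw [Set.Finite.mem_toFinset] at hL hM
      by_cases hLM : L = M
      · obtain ⟨P, hPL, hP⟩ := PGLine.exists_PGmem_not_PGmem hL.1
        exact ⟨P, hP, hPL, hLM ▸ hPL⟩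
      · obtain ⟨P, hPL, hPM⟩ := PGLine.exists_PGmem_PGmem L M
        refine ⟨P, fun hP => hLM (hinj hL hM ?_), hPL, hPM⟩
        rw [← PGLine.eq_of_PGmem hL.1 hPL hP (htL L hL) (ht L hL).2,
          ← PGLine.eq_of_PGmem hM.1 hPM hP (htL M hM) (ht M hM).2])
  have hAcard : hAfin.toFinset.card = 15 := by rw [← Set.ncard_eq_toFinset_card _ hAfin, hA]
  have hbound := twenty_one_le_card_of_affine_blocking ℓ (hAfin.toFinset ∪ C)
    ((Finset.card_pos.mp (by omega)).mono Finset.subset_union_left)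
    (fun P hP => by
      obtain hP | hP := Finset.mem_union.mp hP
      · obtain ⟨hPS, hP⟩ := hAfin.mem_toFinset.mp hP
        exact fun hPℓ => hP ⟨hPS, hPℓ⟩
      · exact hCoff P hP)
    (fun L hL => by
      by_cases hLm : L ∈ missed
      · obtain ⟨P, hP, hPL⟩ := hCmeet L (hmfin.mem_toFinset.mpr hLm)
        exact ⟨P, Finset.mem_union_right _ hP, hPL⟩
      · obtain ⟨P, hPS, hPL, hP⟩ : ∃ P ∈ S, PGmem P L ∧ ¬ PGmem P ℓ := by
          by_contra! hall
          exact hLm ⟨hL, hall⟩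
        exact ⟨P, Finset.mem_union_left _ (hAfin.mem_toFinset.mpr ⟨hPS, fun h => hP h.2⟩), hPL⟩)
  have := Finset.card_union_le hAfin.toFinset C
  omega
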